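/- arXiv:1510.01795 — 4 statements merged into one kernel-verified Lean document; each statement's English description precedes it below -/
import Mathlib

section
/- Let m ≥ 1 be an integer. The principal ideal (u^m) of K[u] is invariant under the one-variable Dunkl operator D (i.e., D f ∈ (u^m) for all f ∈ (u^m)) if and only if m is odd and c = m/2. Consequently, exactly for these values of the parameter c does D descend to the m-dimensional quotient K[u]/(u^m), which realizes the unique finite-dimensional irreducible representation of the rational Cherednik algebra H_{m/2}(S₂) described in the paper. -/
open Polynomial

/-- The Dunkl operator acts on coefficients by a weighted shift. -/
theorem coeff_derivative_add_smul_of_X_mul_eq {R : Type*} [CommRing R] (c : R) {f g : R[X]}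
    (hg : X * g = f.comp (-X) - f) (n : ℕ) :
    (derivative f + c • g).coeff n =
      ((n + 1 : R) + c * ((-1) ^ (n + 1) - 1)) * f.coeff (n + 1) := by
  have h := congrArg (fun p => coeff p (n + 1)) hg
  have hneg : (-X : R[X]) = C (-1) * X := by simp
  simp only [coeff_X_mul, coeff_sub, hneg, comp_C_mul_X_coeff] at h
  rw [coeff_add, coeff_derivative, coeff_smul, smul_eq_mul, h]
  ring

/-- Let `m ≥ 1`.  The ideal `(u^m) ⊆ K[u]` is invariant under the one-variable Dunkl
operator `D f = f' + c·(f(−u) − f(u))/u` if and only if `m` is odd and `c = m/2`.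
(The quotient `d f = (f(−u) − f(u))/u` is characterized by `u · d f = f(−u) − f(u)`,
which determines it uniquely.) -/
theorem dunkl_preserves_ideal_iff (K : Type*) [Field K] [CharZero K] (c : K)
    (d : Polynomial K → Polynomial K)
    (hd : ∀ f : Polynomial K,
      Polynomial.X * d f = f.comp (-Polynomial.X) - f)
    (D : Polynomial K → Polynomial K)
    (hD : ∀ f : Polynomial K, D f = Polynomial.derivative f + c • d f)
    (m : ℕ) (hm : 1 ≤ m) :
    (∀ f ∈ Ideal.span {(Polynomial.X : Polynomial K) ^ m},
        D f ∈ Ideal.span {(Polynomial.X : Polynomial K) ^ m}) ↔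
      (Odd m ∧ c = (m : K) / 2) := by
  simp only [Ideal.mem_span_singleton, X_pow_dvd_iff]
  have hcoeff (f : K[X]) (n : ℕ) : (D f).coeff n =
      ((n + 1 : K) + c * ((-1) ^ (n + 1) - 1)) * f.coeff (n + 1) := by
    rw [hD]
    exact coeff_derivative_add_smul_of_X_mul_eq c (hd f) n
  obtain ⟨k, rfl⟩ : ∃ k, m = k + 1 := ⟨m - 1, by omega⟩
  constructor
  · intro h
    have h0 := h (X ^ (k + 1)) (fun i hi => by rw [coeff_X_pow, if_neg hi.ne]) k k.lt_succ_self
    rw [hcoeff, coeff_X_pow_self, mul_one] at h0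
    rcases Nat.even_or_odd (k + 1) with he | ho
    · rw [he.neg_one_pow, sub_self, mul_zero, add_zero] at h0
      exact absurd h0 k.cast_add_one_ne_zero
    · refine ⟨ho, ?_⟩
      rw [ho.neg_one_pow] at h0
      push_cast
      linear_combination (-1 / 2 : K) * h0
  · rintro ⟨ho, rfl⟩ f hf n hn
    rw [hcoeff]
    rcases Nat.lt_succ_iff_lt_or_eq.mp hn with hlt | rfl
    · rw [hf (n + 1) (by omega), mul_zero]
    · rw [ho.neg_one_pow]
      push_cast
      ring
end

section
/- Each Demazure–Lusztig operator satisfies the Hecke quadratic relation: as K-linear endomorphisms of F = K(x₁,…,xₙ), T_i² = (𝔰 − 𝔰⁻¹)·T_i + id, equivalently (T_i − 𝔰·id) ∘ (T_i + 𝔰⁻¹·id) = 0, for every 1 ≤ i ≤ n−1. (This is the quadratic Hecke relation of the double affine Hecke algebra, verified in its polynomial representation.) -/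
noncomputable section

/-- The automorphism `s_{ij}` of the fraction field `K(x₁,…,xₙ)` induced by the
automorphism of `K[x₁,…,xₙ]` swapping the variables `x_i` and `x_j`. -/
def swapFrac (K : Type*) [Field K] (n : ℕ) (i j : Fin n) :
    FractionRing (MvPolynomial (Fin n) K) ≃+* FractionRing (MvPolynomial (Fin n) K) :=
  IsFractionRing.ringEquivOfRingEquiv
    ((MvPolynomial.renameEquiv K (Equiv.swap i j)).toRingEquiv)

/-- The image of the variable `x_i` in the fraction field `K(x₁,…,xₙ)`. -/
def xFrac (K : Type*) [Field K] (n : ℕ) (i : Fin n) :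
    FractionRing (MvPolynomial (Fin n) K) :=
  algebraMap (MvPolynomial (Fin n) K) (FractionRing (MvPolynomial (Fin n) K))
    (MvPolynomial.X i)

/-- The Demazure–Lusztig operator (for the transposition of positions `i`, `j`):
`T f = 𝔰·(s f) + (𝔰 − 𝔰⁻¹)·(s f − f)/(x_i/x_j − 1)`, acting on `K(x₁,…,xₙ)`. -/
def DL (K : Type*) [Field K] (n : ℕ) (s : K) (i j : Fin n)
    (f : FractionRing (MvPolynomial (Fin n) K)) :
    FractionRing (MvPolynomial (Fin n) K) :=
  algebraMap (MvPolynomial (Fin n) K) (FractionRing (MvPolynomial (Fin n) K))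
      (MvPolynomial.C s) * swapFrac K n i j f
  + (algebraMap (MvPolynomial (Fin n) K) (FractionRing (MvPolynomial (Fin n) K))
        (MvPolynomial.C s)
      - (algebraMap (MvPolynomial (Fin n) K) (FractionRing (MvPolynomial (Fin n) K))
          (MvPolynomial.C s))⁻¹)
    * (swapFrac K n i j f - f) / (xFrac K n i / xFrac K n j - 1)

/-- The abstract quadratic relation: an involution `σ` of a field fixing `q` and exchanging
`x` and `y` gives a Demazure–Lusztig operator satisfying the Hecke relation. -/
theorem demazureLusztig_quadratic_of_involution {F : Type*} [Field F] (σ : F ≃+* F)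
    (q x y f : F) (hσ : σ (σ f) = f) (hq : q ≠ 0) (hσq : σ q = q) (hσx : σ x = y)
    (hσy : σ y = x) (hy : y ≠ 0) (hxy : x ≠ y) :
    q * σ (q * σ f + (q - q⁻¹) * (σ f - f) / (x / y - 1))
        + (q - q⁻¹) * (σ (q * σ f + (q - q⁻¹) * (σ f - f) / (x / y - 1))
          - (q * σ f + (q - q⁻¹) * (σ f - f) / (x / y - 1))) / (x / y - 1)
      = (q - q⁻¹) * (q * σ f + (q - q⁻¹) * (σ f - f) / (x / y - 1)) + f := by
  have hd : x - y ≠ 0 := sub_ne_zero.mpr hxy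
  have hxy_div : x / y - 1 = (x - y) / y := by field_simp
  simp only [map_add, map_mul, map_sub, map_div₀, map_inv₀, hσ, hσq, hσx, hσy,
    hxy_div]
  field_simp
  ring

theorem swapFrac_algebraMap (K : Type*) [Field K] (n : ℕ) (i j : Fin n)
    (p : MvPolynomial (Fin n) K) :
    swapFrac K n i j (algebraMap _ _ p)
      = algebraMap _ _ (MvPolynomial.rename (Equiv.swap i j) p) := by
  simp [swapFrac]

theorem swapFrac_swapFrac (K : Type*) [Field K] (n : ℕ) (i j : Fin n)
    (f : FractionRing (MvPolynomial (Fin n) K)) :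
    swapFrac K n i j (swapFrac K n i j f) = f := by
  obtain ⟨a, b, -, rfl⟩ := IsFractionRing.div_surjective (A := MvPolynomial (Fin n) K) f
  have hswap : (Equiv.swap i j : Fin n → Fin n) ∘ Equiv.swap i j = id := by
    ext k; simp
  simp only [map_div₀, swapFrac_algebraMap, MvPolynomial.rename_rename, hswap,
    MvPolynomial.rename_id_apply]

theorem xFrac_injective (K : Type*) [Field K] (n : ℕ) : Function.Injective (xFrac K n) :=
  (IsFractionRing.injective _ _).comp MvPolynomial.X_injective

theorem xFrac_ne_zero (K : Type*) [Field K] (n : ℕ) (i : Fin n) : xFrac K n i ≠ 0 := by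
  simp [xFrac]

/-- Each Demazure–Lusztig operator satisfies the Hecke quadratic relation
`T_i² = (𝔰 − 𝔰⁻¹)·T_i + id` as an operator on `F = K(x₁,…,xₙ)`. -/
theorem DL_quadratic_relation (K : Type*) [Field K] (n : ℕ) (𝔰 : K) (h𝔰 : 𝔰 ≠ 0)
    (i : ℕ) (hi : i + 1 < n) (f : FractionRing (MvPolynomial (Fin n) K)) :
    DL K n 𝔰 ⟨i, by omega⟩ ⟨i + 1, hi⟩ (DL K n 𝔰 ⟨i, by omega⟩ ⟨i + 1, hi⟩ f)
      = (algebraMap (MvPolynomial (Fin n) K) (FractionRing (MvPolynomial (Fin n) K))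
            (MvPolynomial.C 𝔰)
          - (algebraMap (MvPolynomial (Fin n) K) (FractionRing (MvPolynomial (Fin n) K))
              (MvPolynomial.C 𝔰))⁻¹)
          * DL K n 𝔰 ⟨i, by omega⟩ ⟨i + 1, hi⟩ f + f := by
  refine demazureLusztig_quadratic_of_involution _ _ _ _ f (swapFrac_swapFrac K n _ _ f)
    ?_ ?_ ?_ ?_ (xFrac_ne_zero K n _) ((xFrac_injective K n).ne ?_)
  · simpa using h𝔰
  · simp [swapFrac_algebraMap]
  · simp [xFrac, swapFrac_algebraMap]
  · simp [xFrac, swapFrac_algebraMap]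
  · simp

end
end

section
/- The Demazure–Lusztig operators satisfy the braid relations: as K-linear endomorphisms of F = K(x₁,…,xₙ), T_i ∘ T_{i+1} ∘ T_i = T_{i+1} ∘ T_i ∘ T_{i+1} for 1 ≤ i ≤ n−2, and T_i ∘ T_k = T_k ∘ T_i whenever |i − k| > 1. (These are the braid relations of the double affine Hecke algebra, verified in its polynomial representation.) -/
noncomputable section

theorem swapFrac_xFrac (K : Type*) [Field K] (n : ℕ) (i j k : Fin n) :
    swapFrac K n i j (xFrac K n k) = xFrac K n (Equiv.swap i j k) := by
  simp [xFrac, swapFrac_algebraMap]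

theorem swapFrac_C (K : Type*) [Field K] (n : ℕ) (i j : Fin n) (a : K) :
    swapFrac K n i j (algebraMap (MvPolynomial (Fin n) K) _ (MvPolynomial.C a)) =
      algebraMap (MvPolynomial (Fin n) K) _ (MvPolynomial.C a) := by
  simp [swapFrac_algebraMap]

/-- Two ring automorphisms of a fraction field agree if they agree on the base ring. -/
theorem FractionRing.ringEquiv_apply_eq {R : Type*} [CommRing R]
    (φ ψ : FractionRing R ≃+* FractionRing R)
    (h : ∀ p : R, φ (algebraMap R _ p) = ψ (algebraMap R _ p)) (f : FractionRing R) :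
    φ f = ψ f :=
  RingHom.congr_fun (IsLocalization.ringHom_ext (nonZeroDivisors R)
    (j := (φ : FractionRing R →+* FractionRing R)) (k := ψ) (RingHom.ext h)) f

theorem swapFrac_braid (K : Type*) [Field K] (n : ℕ) {i j k : Fin n} (hij : i ≠ j) (hik : i ≠ k)
    (hjk : j ≠ k) (f : FractionRing (MvPolynomial (Fin n) K)) :
    swapFrac K n i j (swapFrac K n j k (swapFrac K n i j f)) =
      swapFrac K n j k (swapFrac K n i j (swapFrac K n j k f)) := by
  refine FractionRing.ringEquiv_apply_eq
    ((swapFrac K n i j).trans ((swapFrac K n j k).trans (swapFrac K n i j)))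
    ((swapFrac K n j k).trans ((swapFrac K n i j).trans (swapFrac K n j k))) (fun p ↦ ?_) f
  simp only [RingEquiv.trans_apply, swapFrac_algebraMap, MvPolynomial.rename_rename]
  congr 3
  funext l
  simp only [Function.comp_apply, Equiv.swap_apply_def]
  grind

theorem swapFrac_comm (K : Type*) [Field K] (n : ℕ) {i j k l : Fin n} (hik : i ≠ k) (hil : i ≠ l)
    (hjk : j ≠ k) (hjl : j ≠ l) (f : FractionRing (MvPolynomial (Fin n) K)) :
    swapFrac K n i j (swapFrac K n k l f) = swapFrac K n k l (swapFrac K n i j f) := by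
  refine FractionRing.ringEquiv_apply_eq
    ((swapFrac K n k l).trans (swapFrac K n i j))
    ((swapFrac K n i j).trans (swapFrac K n k l)) (fun p ↦ ?_) f
  simp only [RingEquiv.trans_apply, swapFrac_algebraMap, MvPolynomial.rename_rename]
  congr 3
  funext m
  simp only [Function.comp_apply, Equiv.swap_apply_def]
  grind

/-- The braid relation for divided-difference operators attached to two involutions of a field
acting on three elements `a`, `b`, `c` by adjacent transpositions. -/
theorem braid_of_involutions {F : Type*} [Field F] (σ τ : F ≃+* F) {a b c q : F}
    (hq : q ≠ 0) (hb : b ≠ 0) (hc : c ≠ 0) (hab : a ≠ b) (hac : a ≠ c) (hbc : b ≠ c)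
    (hσq : σ q = q) (hτq : τ q = q)
    (hσa : σ a = b) (hσb : σ b = a) (hσc : σ c = c)
    (hτa : τ a = a) (hτb : τ b = c) (hτc : τ c = b)
    (hσσ : ∀ f, σ (σ f) = f) (hττ : ∀ f, τ (τ f) = f)
    (hστ : ∀ f, σ (τ (σ f)) = τ (σ (τ f))) (S T : F → F)
    (hS : ∀ f, S f = q * σ f + (q - q⁻¹) * (σ f - f) / (a / b - 1))
    (hT : ∀ f, T f = q * τ f + (q - q⁻¹) * (τ f - f) / (b / c - 1)) (f : F) :
    S (T (S f)) = T (S (T f)) := by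
  simp only [hS, hT, map_add, map_sub, map_mul, map_div₀, map_inv₀, hσq, hτq, hσa, hσb,
    hσc, hτa, hτb, hτc, hσσ, hττ, hστ, div_sub_one hb, div_sub_one hc]
  generalize τ (σ (τ f)) = f₅
  generalize τ (σ f) = f₄
  generalize σ (τ f) = f₃
  generalize τ f = f₂
  generalize σ f = f₁
  field_simp
  ring

theorem comm_of_involutions {F : Type*} [Field F] (σ τ : F ≃+* F) {a b c d q : F}
    (hσq : σ q = q) (hτq : τ q = q)
    (hσc : σ c = c) (hσd : σ d = d) (hτa : τ a = a) (hτb : τ b = b)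
    (hστ : ∀ f, σ (τ f) = τ (σ f)) (S T : F → F)
    (hS : ∀ f, S f = q * σ f + (q - q⁻¹) * (σ f - f) / (a / b - 1))
    (hT : ∀ f, T f = q * τ f + (q - q⁻¹) * (τ f - f) / (c / d - 1)) (f : F) :
    S (T f) = T (S f) := by
  simp only [hS, hT, map_add, map_sub, map_mul, map_div₀, map_inv₀, map_one, hσq, hτq, hσc, hσd,
    hτa, hτb, hστ]
  ring

theorem DL_braid (K : Type*) [Field K] (n : ℕ) {s : K} (hs : s ≠ 0) {i j k : Fin n}
    (hij : i ≠ j) (hik : i ≠ k) (hjk : j ≠ k) (f : FractionRing (MvPolynomial (Fin n) K)) :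
    DL K n s i j (DL K n s j k (DL K n s i j f)) =
      DL K n s j k (DL K n s i j (DL K n s j k f)) := by
  have hx {l m : Fin n} (h : l ≠ m) : xFrac K n l ≠ xFrac K n m := (xFrac_injective K n).ne h
  refine braid_of_involutions (swapFrac K n i j) (swapFrac K n j k) ?_
    (xFrac_ne_zero K n j) (xFrac_ne_zero K n k) (hx hij) (hx hik) (hx hjk)
    (swapFrac_C K n i j s) (swapFrac_C K n j k s) ?_ ?_ ?_ ?_ ?_ ?_
    (swapFrac_swapFrac K n i j) (swapFrac_swapFrac K n j k) (swapFrac_braid K n hij hik hjk)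
    _ _ (fun _ ↦ rfl) (fun _ ↦ rfl) f
  · simpa using hs
  all_goals
    simp [swapFrac_xFrac, Equiv.swap_apply_of_ne_of_ne, hij, hik, hik.symm, hjk.symm]

theorem DL_comm (K : Type*) [Field K] (n : ℕ) (s : K) {i j k l : Fin n}
    (hik : i ≠ k) (hil : i ≠ l) (hjk : j ≠ k) (hjl : j ≠ l)
    (f : FractionRing (MvPolynomial (Fin n) K)) :
    DL K n s i j (DL K n s k l f) = DL K n s k l (DL K n s i j f) := by
  refine comm_of_involutions (swapFrac K n i j) (swapFrac K n k l)
    (swapFrac_C K n i j s) (swapFrac_C K n k l s) ?_ ?_ ?_ ?_ (swapFrac_comm K n hik hil hjk hjl)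
    _ _ (fun _ ↦ rfl) (fun _ ↦ rfl) f
  all_goals
    simp [swapFrac_xFrac, Equiv.swap_apply_of_ne_of_ne, hik, hil, hjk, hjl, hik.symm, hil.symm,
      hjk.symm, hjl.symm]

/-- The Demazure–Lusztig operators satisfy the braid relations:
`T_i T_{i+1} T_i = T_{i+1} T_i T_{i+1}` for adjacent indices, and `T_i T_k = T_k T_i`
whenever `|i − k| > 1`, as operators on `F = K(x₁,…,xₙ)`. -/
theorem DL_braid_relations (K : Type*) [Field K] (n : ℕ) (hn : 3 ≤ n) (𝔰 : K) (h𝔰 : 𝔰 ≠ 0) :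
    (∀ (i : ℕ) (hi : i + 2 < n) (f : FractionRing (MvPolynomial (Fin n) K)),
      DL K n 𝔰 ⟨i, by omega⟩ ⟨i + 1, by omega⟩
          (DL K n 𝔰 ⟨i + 1, by omega⟩ ⟨i + 2, hi⟩
            (DL K n 𝔰 ⟨i, by omega⟩ ⟨i + 1, by omega⟩ f))
        = DL K n 𝔰 ⟨i + 1, by omega⟩ ⟨i + 2, hi⟩
            (DL K n 𝔰 ⟨i, by omega⟩ ⟨i + 1, by omega⟩
              (DL K n 𝔰 ⟨i + 1, by omega⟩ ⟨i + 2, hi⟩ f))) ∧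
    (∀ (i k : ℕ) (hi : i + 1 < n) (hk : k + 1 < n),
      (i + 1 < k ∨ k + 1 < i) →
      ∀ f : FractionRing (MvPolynomial (Fin n) K),
        DL K n 𝔰 ⟨i, by omega⟩ ⟨i + 1, hi⟩
            (DL K n 𝔰 ⟨k, by omega⟩ ⟨k + 1, hk⟩ f)
          = DL K n 𝔰 ⟨k, by omega⟩ ⟨k + 1, hk⟩
              (DL K n 𝔰 ⟨i, by omega⟩ ⟨i + 1, hi⟩ f)) := by
  refine ⟨fun i hi f ↦ DL_braid K n h𝔰 ?_ ?_ ?_ f, fun i k hi hk hik f ↦ DL_comm K n 𝔰 ?_ ?_ ?_ ?_ f⟩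
  all_goals
    rw [Ne, Fin.mk.injEq]
    omega

end
end

section
/- Let I be the ideal of K[u₂, v₂, v₃] generated by the coefficients of all powers of z in the polynomial (1 + u₂z²)³ − (1 + v₂z² + v₃z³)² (coefficients taken in K[u₂, v₂, v₃]). Then u₂² ∈ I and v₃ ∈ I, and the quotient K-algebra K[u₂, v₂, v₃]/I is isomorphic to K[X]/(X²) via an isomorphism sending the class of u₂ to the class of X. (This is the paper's presentation of the reduced uncolored Koszul model 𝓜_{2,3}(1) of the trefoil: its coordinate ring is generated by u₂ with the single relation u₂² = 0.) -/
noncomputable section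

variable (K : Type*) [Field K] [CharZero K]

/-- The variable `u₂` of `K[u₂, v₂, v₃]`. -/
def u₂ : MvPolynomial (Fin 3) K := MvPolynomial.X 0
/-- The variable `v₂` of `K[u₂, v₂, v₃]`. -/
def v₂ : MvPolynomial (Fin 3) K := MvPolynomial.X 1
/-- The variable `v₃` of `K[u₂, v₂, v₃]`. -/
def v₃ : MvPolynomial (Fin 3) K := MvPolynomial.X 2

/-- The polynomial `(1 + u₂z²)³ − (1 + v₂z² + v₃z³)²` in `z`, with coefficients in
`K[u₂, v₂, v₃]`. -/
def trefoilPoly : Polynomial (MvPolynomial (Fin 3) K) :=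
  (1 + Polynomial.C (u₂ K) * Polynomial.X ^ 2) ^ 3
    - (1 + Polynomial.C (v₂ K) * Polynomial.X ^ 2
        + Polynomial.C (v₃ K) * Polynomial.X ^ 3) ^ 2

/-- The ideal of `K[u₂, v₂, v₃]` generated by the coefficients of all powers of `z`
in `(1 + u₂z²)³ − (1 + v₂z² + v₃z³)²`. -/
def trefoilIdeal : Ideal (MvPolynomial (Fin 3) K) :=
  Ideal.span (Set.range fun k : ℕ => (trefoilPoly K).coeff k)

set_option linter.unusedSectionVars false in
theorem trefoilPoly_eq : trefoilPoly K =
    Polynomial.C (3 * u₂ K - 2 * v₂ K) * Polynomial.X ^ 2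
      + Polynomial.C (-2 * v₃ K) * Polynomial.X ^ 3
      + Polynomial.C (3 * u₂ K ^ 2 - v₂ K ^ 2) * Polynomial.X ^ 4
      + Polynomial.C (-2 * v₂ K * v₃ K) * Polynomial.X ^ 5
      + Polynomial.C (u₂ K ^ 3 - v₃ K ^ 2) * Polynomial.X ^ 6 := by
  simp only [trefoilPoly, map_sub, map_mul, map_pow, map_neg, map_ofNat]
  ring

set_option linter.unusedSectionVars false in
theorem coeff_trefoilPoly_mem (k : ℕ) : (trefoilPoly K).coeff k ∈ trefoilIdeal K :=
  Ideal.subset_span ⟨k, rfl⟩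

set_option linter.unusedSectionVars false in
theorem three_mul_u₂_sub_mem : 3 * u₂ K - 2 * v₂ K ∈ trefoilIdeal K := by
  simpa [trefoilPoly_eq, Polynomial.coeff_X_pow, -map_sub, -map_mul, -map_neg] using
    coeff_trefoilPoly_mem K 2

theorem isUnit_ofNat_mvPolynomial (n : ℕ) [n.AtLeastTwo] :
    IsUnit (OfNat.ofNat n : MvPolynomial (Fin 3) K) := by
  rw [← map_ofNat (MvPolynomial.C : K →+* MvPolynomial (Fin 3) K) n]
  exact (isUnit_iff_ne_zero.mpr (OfNat.ofNat_ne_zero n)).map _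

theorem v₃_mem_trefoilIdeal : v₃ K ∈ trefoilIdeal K := by
  have h : -2 * v₃ K ∈ trefoilIdeal K := by
    simpa [trefoilPoly_eq, Polynomial.coeff_X_pow, -map_sub, -map_mul, -map_neg] using
      coeff_trefoilPoly_mem K 3
  exact (Ideal.unit_mul_mem_iff_mem _ (isUnit_ofNat_mvPolynomial K 2).neg).mp h

theorem u₂_sq_mem_trefoilIdeal : u₂ K ^ 2 ∈ trefoilIdeal K := by
  have h : 3 * u₂ K ^ 2 - v₂ K ^ 2 ∈ trefoilIdeal K := by
    simpa [trefoilPoly_eq, Polynomial.coeff_X_pow, -map_sub, -map_mul, -map_neg] using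
      coeff_trefoilPoly_mem K 4
  refine (Ideal.unit_mul_mem_iff_mem _ (isUnit_ofNat_mvPolynomial K 3)).mp ?_
  convert sub_mem (Ideal.mul_mem_left _ 4 h)
    (Ideal.mul_mem_left _ (3 * u₂ K + 2 * v₂ K) (three_mul_u₂_sub_mem K)) using 1
  ring

theorem three_halves_smul_eq_iff {A : Type*} [CommRing A] [Algebra K A] (x w : A) :
    (3 / 2 : K) • x = w ↔ 3 * x = 2 * w := by
  have h3 : (3 : K) • x = 3 * x := by rw [Algebra.smul_def, map_ofNat]
  have h2 : (2 : K) • w = 2 * w := by rw [Algebra.smul_def, map_ofNat]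
  rw [← h3, ← h2, div_eq_inv_mul, mul_smul, inv_smul_eq_iff₀ two_ne_zero]

/-- A `K`-algebra map vanishes on the trefoil ideal as soon as it sends `(u₂, v₂, v₃)` to a
triple `(x, 3/2 x, 0)` with `x² = 0`. -/
theorem map_eq_zero_of_mem_trefoilIdeal {A : Type*} [CommRing A] [Algebra K A]
    (f : MvPolynomial (Fin 3) K →ₐ[K] A) (hu : f (u₂ K) ^ 2 = 0)
    (hv : f (v₂ K) = (3 / 2 : K) • f (u₂ K)) (hw : f (v₃ K) = 0)
    (p : MvPolynomial (Fin 3) K) (hp : p ∈ trefoilIdeal K) : f p = 0 := by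
  have hv2 : f (v₂ K) ^ 2 = 0 := by rw [hv, smul_pow, hu, smul_zero]
  have hu3 : f (u₂ K) ^ 3 = 0 := by rw [pow_succ, hu, zero_mul]
  have huv : 3 * f (u₂ K) - 2 * f (v₂ K) = 0 :=
    sub_eq_zero.mpr ((three_halves_smul_eq_iff K _ _).mp hv.symm)
  have hP : (trefoilPoly K).map (f : MvPolynomial (Fin 3) K →+* A) = 0 := by
    simp only [trefoilPoly_eq, Polynomial.map_add, Polynomial.map_mul, Polynomial.map_pow,
      Polynomial.map_X, Polynomial.map_C, RingHom.coe_coe, map_sub f, map_mul f, map_pow f,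
      map_ofNat f, huv, hu, hv2, hu3, hw]
    simp
  suffices h : trefoilIdeal K ≤ RingHom.ker f from h hp
  refine Ideal.span_le.mpr ?_
  rintro _ ⟨k, rfl⟩
  simpa using congrArg (Polynomial.coeff · k) hP

/-- For the reduced uncolored Koszul model `𝓜_{2,3}(1)` of the trefoil: `u₂² ∈ I`,
`v₃ ∈ I`, and `K[u₂, v₂, v₃]/I ≅ K[X]/(X²)` via an isomorphism sending the class of
`u₂` to the class of `X`. -/
theorem trefoil_koszul_model :
    u₂ K ^ 2 ∈ trefoilIdeal K ∧ v₃ K ∈ trefoilIdeal K ∧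
    ∃ e : (MvPolynomial (Fin 3) K ⧸ trefoilIdeal K) ≃ₐ[K]
        (Polynomial K ⧸ Ideal.span {(Polynomial.X : Polynomial K) ^ 2}),
      e (Ideal.Quotient.mk (trefoilIdeal K) (u₂ K))
        = Ideal.Quotient.mk (Ideal.span {(Polynomial.X : Polynomial K) ^ 2})
            Polynomial.X := by
  refine ⟨u₂_sq_mem_trefoilIdeal K, v₃_mem_trefoilIdeal K, ?_⟩
  let J : Ideal (Polynomial K) := Ideal.span {Polynomial.X ^ 2}
  let x : Polynomial K ⧸ J := Ideal.Quotient.mk J Polynomial.X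
  let y : MvPolynomial (Fin 3) K ⧸ trefoilIdeal K := Ideal.Quotient.mk _ (u₂ K)
  have hx : x ^ 2 = 0 := Ideal.Quotient.eq_zero_iff_mem.mpr (Ideal.mem_span_singleton_self _)
  have hy : y ^ 2 = 0 := Ideal.Quotient.eq_zero_iff_mem.mpr (u₂_sq_mem_trefoilIdeal K)
  have hv : (3 / 2 : K) • y = Ideal.Quotient.mk _ (v₂ K) :=
    (three_halves_smul_eq_iff K y (Ideal.Quotient.mk _ (v₂ K))).mpr <|
      sub_eq_zero.mp (Ideal.Quotient.eq_zero_iff_mem.mpr (three_mul_u₂_sub_mem K))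
  let f : MvPolynomial (Fin 3) K →ₐ[K] Polynomial K ⧸ J :=
    MvPolynomial.aeval ![x, (3 / 2 : K) • x, 0]
  have hfu : f (u₂ K) = x := by simp [f, u₂]
  have hfv : f (v₂ K) = (3 / 2 : K) • x := by simp [f, v₂]
  have hfw : f (v₃ K) = 0 := by simp [f, v₃]
  let F : (MvPolynomial (Fin 3) K ⧸ trefoilIdeal K) →ₐ[K] Polynomial K ⧸ J :=
    Ideal.Quotient.liftₐ _ f <| map_eq_zero_of_mem_trefoilIdeal K f (by rw [hfu, hx])
      (by rw [hfu, hfv]) hfw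
  let G : (Polynomial K ⧸ J) →ₐ[K] MvPolynomial (Fin 3) K ⧸ trefoilIdeal K :=
    Ideal.Quotient.liftₐ J (Polynomial.aeval y) fun p hp => by
      obtain ⟨q, rfl⟩ := Ideal.mem_span_singleton.mp hp
      simp [hy]
  have hG : G x = y := Polynomial.aeval_X y
  refine ⟨AlgEquiv.ofAlgHom F G ?_ ?_, hfu⟩
  · refine Ideal.Quotient.algHom_ext _ (Polynomial.algHom_ext ?_)
    change F (G x) = x
    rw [hG]
    exact hfu
  · refine Ideal.Quotient.algHom_ext _ (MvPolynomial.algHom_ext fun i => ?_)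
    change G (f (MvPolynomial.X i)) = Ideal.Quotient.mk _ (MvPolynomial.X i)
    fin_cases i
    · exact (congrArg G hfu).trans hG
    · refine (congrArg G hfv).trans ?_
      rw [map_smul, hG]
      exact hv
    · refine (congrArg G hfw).trans ?_
      rw [map_zero]
      exact (Ideal.Quotient.eq_zero_iff_mem.mpr (v₃_mem_trefoilIdeal K)).symm

end
end
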